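/- For w = 1 and for w = −1, the characteristic polynomial of the 10×10 matrix H_10(w) factorizes as det(X·I − H_10(±1)) = X²·(X² − 1)²·(X² − 3)². In particular, at the exceptional-point values w = ±1 the ten eigenvalues degenerate into the five doubly degenerate values 0, ±1, ±√3. -/

import Mathlib

open Matrix Polynomial

/-- The `10 × 10` complex matrix `H_10(w)` (0-based indices `0,…,9`): `-1` on the
sub- and super-diagonal, diagonal entries zero except `-i·w` at position `4`
(1-based `5`) and `i·w` at position `5` (1-based `6`). -/
noncomputable def H10 (w : ℂ) : Matrix (Fin 10) (Fin 10) ℂ :=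
  Matrix.of fun k l =>
    if (k : ℕ) + 1 = (l : ℕ) ∨ (l : ℕ) + 1 = (k : ℕ) then -1
    else if k = l then
      if (k : ℕ) = 4 then -Complex.I * w
      else if (k : ℕ) = 5 then Complex.I * w
      else 0
    else 0

/-- The `n × n` tridiagonal matrix with diagonal entries `a 0, …, a (n - 1)` and all entries on
the sub- and super-diagonal equal to `1`. -/
def unitTridiagonal {R : Type*} [CommRing R] (n : ℕ) (a : ℕ → R) : Matrix (Fin n) (Fin n) R :=
  Matrix.of fun k l =>
    if (k : ℕ) + 1 = (l : ℕ) ∨ (l : ℕ) + 1 = (k : ℕ) then 1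
    else if k = l then a k
    else 0

theorem unitTridiagonal_submatrix_succ {R : Type*} [CommRing R] (n : ℕ) (a : ℕ → R) :
    (unitTridiagonal (n + 1) a).submatrix Fin.succ Fin.succ =
      unitTridiagonal n fun k => a (k + 1) := by
  ext k l
  simp [unitTridiagonal]

theorem det_unitTridiagonal_zero {R : Type*} [CommRing R] (a : ℕ → R) :
    (unitTridiagonal 0 a).det = 1 :=
  Matrix.det_fin_zero

theorem det_unitTridiagonal_one {R : Type*} [CommRing R] (a : ℕ → R) :
    (unitTridiagonal 1 a).det = a 0 := by
  simp [unitTridiagonal]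

theorem det_unitTridiagonal_add_two {R : Type*} [CommRing R] (n : ℕ) (a : ℕ → R) :
    (unitTridiagonal (n + 2) a).det =
      a 0 * (unitTridiagonal (n + 1) fun k => a (k + 1)).det -
        (unitTridiagonal n fun k => a (k + 2)).det := by
  have minor : ((unitTridiagonal (n + 2) a).submatrix Fin.succ (Fin.succAbove 1)).det =
      (unitTridiagonal n fun k => a (k + 2)).det := by
    have sub : ((unitTridiagonal (n + 2) a).submatrix Fin.succ (Fin.succAbove 1)).submatrix
        Fin.succ Fin.succ = unitTridiagonal n fun k => a (k + 2) := by
      ext k l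
      have h : (Fin.succAbove (1 : Fin (n + 2)) l.succ) = l.succ.succ := by
        rw [← Fin.succ_zero_eq_one, Fin.succ_succAbove_succ, Fin.succAbove_zero]
      simp [unitTridiagonal, h]
    rw [Matrix.det_succ_column_zero, Fin.sum_univ_succ, Finset.sum_eq_zero]
    · rw [Fin.succAbove_zero, sub]
      simp [unitTridiagonal]
    · intro i _
      simp [unitTridiagonal, Fin.ext_iff]
  rw [Matrix.det_succ_row_zero, Fin.sum_univ_succ, Fin.sum_univ_succ, Finset.sum_eq_zero]
  · rw [Fin.succAbove_zero, unitTridiagonal_submatrix_succ, Fin.succ_zero_eq_one, minor]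
    simp [unitTridiagonal, sub_eq_add_neg]
  · intro i _
    simp [unitTridiagonal, Fin.ext_iff]

theorem det_unitTridiagonal_ten {R : Type*} [CommRing R] {x c : R} (hc : c ^ 2 = -1) :
    (unitTridiagonal 10 fun k => if k = 4 then x + c else if k = 5 then x - c else x).det =
      x ^ 2 * (x ^ 2 - 1) ^ 2 * (x ^ 2 - 3) ^ 2 := by
  simp only [det_unitTridiagonal_add_two, det_unitTridiagonal_zero,
    show ∀ a : ℕ → R, (unitTridiagonal (0 + 1) a).det = a 0 from det_unitTridiagonal_one]
  norm_num only [if_true, if_false]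
  linear_combination (-(x ^ 4 - 3 * x ^ 2 + 1) ^ 2) * hc

theorem charmatrix_H10 (w : ℂ) :
    (H10 w).charmatrix = unitTridiagonal 10 fun k =>
      if k = 4 then X + C (Complex.I * w) else if k = 5 then X - C (Complex.I * w) else X := by
  ext1 k l
  by_cases hkl : k = l
  · subst hkl
    simp only [charmatrix_apply_eq, H10, unitTridiagonal, Matrix.of_apply]
    split_ifs <;> simp_all
  · rw [charmatrix_apply_ne _ _ _ hkl]
    simp only [H10, unitTridiagonal, Matrix.of_apply, if_neg hkl]
    split_ifs <;> simp

theorem charpoly_H10_of_sq_eq_one {w : ℂ} (hw : w ^ 2 = 1) :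
    (H10 w).charpoly = X ^ 2 * (X ^ 2 - 1) ^ 2 * (X ^ 2 - 3) ^ 2 := by
  rw [Matrix.charpoly, charmatrix_H10]
  apply det_unitTridiagonal_ten
  rw [← C_pow, mul_pow, hw, Complex.I_sq, mul_one, C_neg, C_1]

/-- At the exceptional-point values `w = ±1`, the characteristic polynomial of
`H_10(w)` factorizes as `X²·(X²−1)²·(X²−3)²`. -/
theorem stmt12 :
    (H10 1).charpoly = X^2 * (X^2 - 1)^2 * (X^2 - 3)^2 ∧
    (H10 (-1)).charpoly = X^2 * (X^2 - 1)^2 * (X^2 - 3)^2 :=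
  ⟨charpoly_H10_of_sq_eq_one (by norm_num), charpoly_H10_of_sq_eq_one (by norm_num)⟩
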